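/- arXiv:2112.01910 — 2 statements merged into one kernel-verified Lean document; each statement's English description precedes it below -/
import Mathlib

section
/- Let G be a bipartite graph containing no cycle of length 4 as a (not necessarily induced) subgraph. Then Γ⃗_LD(G) = α(G), where α(G) is the maximum size of an independent set of G. -/
open SimpleGraph

/-- `S` is a locating-dominating set of the undirected graph `G`. -/
def IsLDSet {V : Type*} (G : SimpleGraph V) (S : Set V) : Prop :=
  (∀ u ∉ S, (G.neighborSet u ∩ S).Nonempty) ∧
    ∀ u ∉ S, ∀ v ∉ S, u ≠ v → G.neighborSet u ∩ S ≠ G.neighborSet v ∩ S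

/-- The location-domination number of the undirected graph `G`. -/
noncomputable def gammaLD {V : Type*} (G : SimpleGraph V) : ℕ :=
  sInf {n | ∃ S : Set V, IsLDSet G S ∧ S.ncard = n}

/-- `D` is an orientation of `G`: every arc of `D` is an edge of `G`, and every
edge of `G` is given exactly one of its two possible directions. -/
def IsOrientation {V : Type*} (G : SimpleGraph V) (D : V → V → Prop) : Prop :=
  (∀ u v, D u v → G.Adj u v) ∧ ∀ u v, G.Adj u v → (D u v ↔ ¬ D v u)

/-- `S` is a locating-dominating set of the directed graph `D`
(arcs given as a relation: `D w u` means there is an arc from `w` to `u`). -/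
def IsDirLDSet {V : Type*} (D : V → V → Prop) (S : Set V) : Prop :=
  (∀ u ∉ S, ({w | D w u} ∩ S).Nonempty) ∧
    ∀ u ∉ S, ∀ v ∉ S, u ≠ v → {w | D w u} ∩ S ≠ {w | D w v} ∩ S

/-- The location-domination number of a directed graph. -/
noncomputable def gammaLDdir {V : Type*} (D : V → V → Prop) : ℕ :=
  sInf {n | ∃ S : Set V, IsDirLDSet D S ∧ S.ncard = n}

/-- The lower directed location-domination number of `G`:
minimum of `gammaLDdir D` over all orientations `D` of `G`. -/
noncomputable def lowerDirLD {V : Type*} (G : SimpleGraph V) : ℕ :=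
  sInf {n | ∃ D : V → V → Prop, IsOrientation G D ∧ gammaLDdir D = n}

/-- The upper directed location-domination number of `G`:
maximum of `gammaLDdir D` over all orientations `D` of `G`. -/
noncomputable def upperDirLD {V : Type*} (G : SimpleGraph V) : ℕ :=
  sSup {n | ∃ D : V → V → Prop, IsOrientation G D ∧ gammaLDdir D = n}

/-- `G` contains no cycle of length 4 as a (not necessarily induced) subgraph. -/
def C4Free {V : Type*} (G : SimpleGraph V) : Prop :=
  ¬ ∃ a b c d : V, a ≠ b ∧ a ≠ c ∧ a ≠ d ∧ b ≠ c ∧ b ≠ d ∧ c ≠ d ∧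
      G.Adj a b ∧ G.Adj b c ∧ G.Adj c d ∧ G.Adj d a

/-- The independence number `α(G)`. -/
noncomputable def indepNumber {V : Type*} (G : SimpleGraph V) : ℕ :=
  sSup {k | ∃ S : Set V, (S.Pairwise fun u v => ¬ G.Adj u v) ∧ S.ncard = k}

/-- Independent sets have at most `indepNumber G` elements. -/
theorem ncard_le_indepNumber {V : Type*} [Fintype V] (G : SimpleGraph V) {S : Set V}
    (hS : S.Pairwise fun u v => ¬ G.Adj u v) : S.ncard ≤ indepNumber G := by
  refine le_csSup ⟨Nat.card V, ?_⟩ ⟨S, hS, rfl⟩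
  rintro _ ⟨T, -, rfl⟩
  exact Set.ncard_le_card T

/-- The independence number is attained. -/
theorem exists_ncard_eq_indepNumber {V : Type*} [Fintype V] (G : SimpleGraph V) :
    ∃ S : Set V, (S.Pairwise fun u v => ¬ G.Adj u v) ∧ S.ncard = indepNumber G := by
  refine Nat.sSup_mem (s := {k | ∃ S : Set V, (S.Pairwise fun u v => ¬ G.Adj u v) ∧ S.ncard = k})
    ⟨0, ∅, Set.pairwise_empty _, Set.ncard_empty V⟩ ⟨Nat.card V, ?_⟩
  rintro _ ⟨T, -, rfl⟩
  exact Set.ncard_le_card T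

/-- In a bipartite graph, the vertices outside a maximum independent set `I` can be matched
into `I`. -/
theorem exists_matching_into_maximum_indep {V : Type*} [Fintype V] (G : SimpleGraph V)
    (col : G.Coloring (Fin 2)) {I : Set V} (hI : I.Pairwise fun u v => ¬ G.Adj u v)
    (hmax : I.ncard = indepNumber G) :
    ∃ f : V → V, Set.InjOn f Iᶜ ∧ ∀ c ∉ I, f c ∈ I ∧ G.Adj c (f c) := by
  classical
  have hall : ∀ k : Fin 2, ∃ f : {c // c ∉ I ∧ col c = k} → V,
      Function.Injective f ∧
        ∀ c : {c // c ∉ I ∧ col c = k}, f c ∈ Finset.univ.filter fun v => v ∈ I ∧ G.Adj c v := by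
    intro k
    rw [← Finset.all_card_le_biUnion_card_iff_exists_injective]
    intro s
    set N := s.biUnion fun c => Finset.univ.filter fun v => v ∈ I ∧ G.Adj c v with hN
    set X : Finset V := s.map (Function.Embedding.subtype _) with hX
    have hXmem : ∀ v, v ∈ X → v ∉ I ∧ col v = k := by
      intro v hv
      simp only [hX, Finset.mem_map, Function.Embedding.subtype_apply] at hv
      obtain ⟨c, -, rfl⟩ := hv
      exact c.2
    have hNmem : ∀ x ∈ X, ∀ v ∈ I, G.Adj x v → v ∈ N := by
      intro x hx v hv hadj
      simp only [hX, Finset.mem_map, Function.Embedding.subtype_apply] at hx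
      obtain ⟨c, hc, rfl⟩ := hx
      simp only [hN, Finset.mem_biUnion, Finset.mem_filter, Finset.mem_univ, true_and]
      exact ⟨c, hc, hv, hadj⟩
    have hNI : N ⊆ I.toFinset := by
      intro v hv
      simp only [hN, Finset.mem_biUnion, Finset.mem_filter, Finset.mem_univ, true_and] at hv
      obtain ⟨_, _, hv, _⟩ := hv
      simpa using hv
    have hindep : (↑((I.toFinset \ N) ∪ X) : Set V).Pairwise fun u v => ¬ G.Adj u v := by
      intro u hu v hv huv hadj
      simp only [Finset.coe_union, Finset.coe_sdiff, Set.coe_toFinset, Set.mem_union,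
        Set.mem_sdiff, Finset.mem_coe] at hu hv
      rcases hu with ⟨hu, huN⟩ | hu <;> rcases hv with ⟨hv, hvN⟩ | hv
      · exact hI hu hv huv hadj
      · exact huN (hNmem v hv u hu hadj.symm)
      · exact hvN (hNmem u hu v hv hadj)
      · exact col.valid hadj ((hXmem u hu).2.trans (hXmem v hv).2.symm)
    have hle := ncard_le_indepNumber G hindep
    have hdisj : Disjoint (I.toFinset \ N) X := by
      rw [Finset.disjoint_left]
      intro v hv hvX
      exact (hXmem v hvX).1 (by simpa using (Finset.mem_sdiff.1 hv).1)
    rw [Set.ncard_coe_finset, Finset.card_union_of_disjoint hdisj, Finset.card_sdiff_of_subset hNI,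
      ← hmax, Set.ncard_eq_toFinset_card'] at hle
    have hNcard := Finset.card_le_card hNI
    have hXcard : X.card = s.card := Finset.card_map _
    omega
  choose f hinj hf using hall
  simp only [Finset.mem_filter, Finset.mem_univ, true_and] at hf
  refine ⟨fun c => if h : c ∉ I then f (col c) ⟨c, h, rfl⟩ else c, ?_, ?_⟩
  · intro c hc d hd hcd
    rw [Set.mem_compl_iff] at hc hd
    simp only [hc, hd, not_false_eq_true, dite_true] at hcd
    have h1 := col.valid (hf (col c) ⟨c, hc, rfl⟩).2
    have h2 := col.valid (hf (col d) ⟨d, hd, rfl⟩).2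
    rw [hcd] at h1
    simp only at h1 h2
    have hcol : col c = col d := by omega
    have key : ∀ (k : Fin 2) (hk : col c = k) (hk' : col d = k),
        f k ⟨c, hc, hk⟩ = f k ⟨d, hd, hk'⟩ → c = d :=
      fun k hk hk' h => congrArg Subtype.val (hinj k h)
    refine key (col d) hcol rfl (Eq.trans ?_ hcd)
    congr 1
    · exact hcol.symm
    · congr! 2
      rw [hcol]
  · intro c hc
    simp only [hc, not_false_eq_true, dite_true]
    exact hf (col c) ⟨c, hc, rfl⟩

/-- A matching covering the complement of `I` by edges into `I` yields, for every orientation of a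
`C₄`-free graph, a locating-dominating set with as many vertices as `I`: the complement of the
set of heads of the matching edges. -/
theorem exists_isDirLDSet_of_matching {V : Type*} [Fintype V] {G : SimpleGraph V}
    (hC4 : C4Free G) {I : Set V} {f : V → V} (hinj : Set.InjOn f Iᶜ)
    (hf : ∀ c ∉ I, f c ∈ I ∧ G.Adj c (f c)) {D : V → V → Prop} (hD : IsOrientation G D) :
    ∃ S : Set V, IsDirLDSet D S ∧ S.ncard = I.ncard := by
  classical
  let head : V → V := fun c => if D (f c) c then c else f c
  let tail : V → V := fun c => if D (f c) c then f c else c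
  have harc : ∀ c ∉ I, D (tail c) (head c) := by
    intro c hc
    by_cases h : D (f c) c
    · simp [head, tail, h]
    · simpa [head, tail, h] using (hD.2 _ _ (hf c hc).2).2 h
  have hhead : Set.InjOn head Iᶜ := by
    intro c hc d hd h
    simp only [head] at h
    split_ifs at h with h1 h2 h2
    · exact h
    · exact absurd (h ▸ (hf d hd).1) hc
    · exact absurd (h ▸ (hf c hc).1) hd
    · exact hinj hc hd h
  have htail : Set.InjOn tail Iᶜ := by
    intro c hc d hd h
    simp only [tail] at h
    split_ifs at h with h1 h2 h2
    · exact hinj hc hd h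
    · exact absurd (h ▸ (hf c hc).1) hd
    · exact absurd (h ▸ (hf d hd).1) hc
    · exact h
  have hne : ∀ c ∉ I, ∀ d ∉ I, tail c ≠ head d := by
    intro c hc d hd h
    simp only [tail, head] at h
    split_ifs at h with h1 h2 h2
    · exact hd (h ▸ (hf c hc).1)
    · exact h2 (hinj hc hd h ▸ h1)
    · exact h1 (h ▸ h2)
    · exact hc (h ▸ (hf d hd).1)
  have htailmem : ∀ c ∉ I, tail c ∈ (head '' Iᶜ)ᶜ := by
    rintro c hc ⟨d, hd, h⟩
    exact hne c hc d hd h.symm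
  refine ⟨(head '' Iᶜ)ᶜ, ⟨?_, ?_⟩, ?_⟩
  · intro u hu
    obtain ⟨c, hc, rfl⟩ := not_not.1 hu
    exact ⟨tail c, harc c hc, htailmem c hc⟩
  · intro u hu v hv huv heq
    obtain ⟨c, hc, rfl⟩ := not_not.1 hu
    obtain ⟨d, hd, rfl⟩ := not_not.1 hv
    have hcd : c ≠ d := fun h => huv (congrArg head h)
    have h1 : tail c ∈ {w | D w (head d)} ∩ (head '' Iᶜ)ᶜ :=
      heq ▸ ⟨harc c hc, htailmem c hc⟩
    have h2 : tail d ∈ {w | D w (head c)} ∩ (head '' Iᶜ)ᶜ :=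
      heq ▸ ⟨harc d hd, htailmem d hd⟩
    exact hC4 ⟨head c, tail c, head d, tail d, (hne c hc c hc).symm, huv, (hne d hd c hc).symm,
      hne c hc d hd, fun h => hcd (htail hc hd h), (hne d hd d hd).symm,
      (hD.1 _ _ (harc c hc)).symm, hD.1 _ _ h1.1, (hD.1 _ _ (harc d hd)).symm, hD.1 _ _ h2.1⟩
  · have h1 := Set.ncard_add_ncard_compl (head '' Iᶜ)
    have h2 := Set.ncard_add_ncard_compl I
    rw [hhead.ncard_image] at h1
    omega

/-- Orienting all edges at an independent set `I` away from `I` forces `I` into every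
locating-dominating set. -/
theorem exists_orientation_ncard_le_gammaLDdir {V : Type*} [Fintype V] (G : SimpleGraph V)
    (col : G.Coloring (Fin 2)) {I : Set V} (hI : I.Pairwise fun u v => ¬ G.Adj u v) :
    ∃ D : V → V → Prop, IsOrientation G D ∧ I.ncard ≤ gammaLDdir D := by
  refine ⟨fun u v => G.Adj u v ∧ v ∉ I ∧ (u ∈ I ∨ col u < col v), ⟨fun u v h => h.1, ?_⟩, ?_⟩
  · intro u v h
    have hcol := col.valid h
    have hvu := h.symm
    have hnot : ¬ (u ∈ I ∧ v ∈ I) := fun hm => hI hm.1 hm.2 h.ne h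
    have hlt : col u < col v ↔ ¬ col v < col u := by omega
    tauto
  · refine le_csInf ⟨_, Set.univ, ⟨fun u hu => absurd (Set.mem_univ u) hu,
      fun u hu => absurd (Set.mem_univ u) hu⟩, rfl⟩ ?_
    rintro _ ⟨S, hS, rfl⟩
    refine Set.ncard_le_ncard (fun u hu => ?_)
    by_contra huS
    obtain ⟨w, hw, -⟩ := hS.1 u huS
    exact hw.2.1 hu

/-- if `G` is bipartite (2-colourable) without a `C₄` subgraph,
then `Γ⃗_LD(G) = α(G)`. -/
theorem stmt17 {V : Type*} [Fintype V] (G : SimpleGraph V)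
    (hbip : G.Colorable 2) (hC4 : C4Free G) :
    upperDirLD G = indepNumber G := by
  obtain ⟨col⟩ := hbip
  obtain ⟨I, hI, hmax⟩ := exists_ncard_eq_indepNumber G
  obtain ⟨f, hinj, hf⟩ := exists_matching_into_maximum_indep G col hI hmax
  have hub : ∀ D : V → V → Prop, IsOrientation G D → gammaLDdir D ≤ indepNumber G := by
    intro D hD
    obtain ⟨S, hS, hcard⟩ := exists_isDirLDSet_of_matching hC4 hinj hf hD
    exact Nat.sInf_le ⟨S, hS, hcard.trans hmax⟩
  obtain ⟨D, hD, hle⟩ := exists_orientation_ncard_le_gammaLDdir G col hI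
  apply le_antisymm
  · refine csSup_le ⟨_, D, hD, rfl⟩ ?_
    rintro _ ⟨D', hD', rfl⟩
    exact hub D' hD'
  · rw [← hmax]
    refine hle.trans (le_csSup ⟨indepNumber G, ?_⟩ ⟨D, hD, rfl⟩)
    rintro _ ⟨D', hD', rfl⟩
    exact hub D' hD'
end

section
/- Let G be a graph whose chromatic number satisfies χ(G) ≤ 3. Then Γ⃗_LD(G) ≥ γ_LD(G). -/
open SimpleGraph

theorem isDirLDSet_univ {V : Type*} (D : V → V → Prop) : IsDirLDSet D Set.univ :=
  ⟨fun u hu => absurd (Set.mem_univ u) hu, fun u hu => absurd (Set.mem_univ u) hu⟩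

theorem gammaLDdir_le_card {V : Type*} (D : V → V → Prop) : gammaLDdir D ≤ Nat.card V :=
  Nat.sInf_le ⟨Set.univ, isDirLDSet_univ D, Set.ncard_univ V⟩

theorem gammaLDdir_le_upperDirLD {V : Type*} {G : SimpleGraph V} {D : V → V → Prop}
    (hD : IsOrientation G D) : gammaLDdir D ≤ upperDirLD G := by
  refine le_csSup ⟨Nat.card V, ?_⟩ ⟨D, hD, rfl⟩
  rintro _ ⟨D', -, rfl⟩
  exact gammaLDdir_le_card D'

theorem gammaLD_le_gammaLDdir {V : Type*} {G : SimpleGraph V} {D : V → V → Prop}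
    (h : ∀ S, IsDirLDSet D S → IsLDSet G S) : gammaLD G ≤ gammaLDdir D := by
  refine le_csInf ⟨_, Set.univ, isDirLDSet_univ D, rfl⟩ ?_
  rintro _ ⟨S, hS, rfl⟩
  exact Nat.sInf_le ⟨S, h S hS, rfl⟩

/-- The orientation of a coloured graph from smaller to larger colours. -/
def colorOrientation {V : Type*} {G : SimpleGraph V} {n : ℕ} (c : G.Coloring (Fin n)) :
    V → V → Prop :=
  fun u v => G.Adj u v ∧ c u < c v

theorem isOrientation_colorOrientation {V : Type*} {G : SimpleGraph V} {n : ℕ}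
    (c : G.Coloring (Fin n)) : IsOrientation G (colorOrientation c) := by
  refine ⟨fun u v h => h.1, fun u v h => ?_⟩
  have hne := c.valid h
  simp only [colorOrientation, h, h.symm, true_and, not_lt]
  exact ⟨le_of_lt, fun hle => lt_of_le_of_ne hle hne⟩

theorem IsDirLDSet.isLDSet_of_colorOrientation {V : Type*} {G : SimpleGraph V}
    (c : G.Coloring (Fin 3)) {S : Set V} (hS : IsDirLDSet (colorOrientation c) S) :
    IsLDSet G S := by
  have lt_of_adj : ∀ u, ∀ v ∉ S, ∀ w, c w < c u → G.Adj w v → c w < c v := by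
    intro u v hv w hwu hwv
    -- Vertices of the smallest colour are sources, so `v` does not have that colour.
    obtain ⟨x, ⟨-, hx⟩, -⟩ := hS.1 v hv
    have hne := c.valid hwv
    omega
  refine ⟨fun u hu => ?_, fun u hu v hv huv heq => hS.2 u hu v hv huv ?_⟩
  · obtain ⟨w, hw, hwS⟩ := hS.1 u hu
    exact ⟨w, hw.1.symm, hwS⟩
  · ext w
    have hw := Set.ext_iff.mp heq w
    constructor
    · rintro ⟨⟨hadj, hlt⟩, hwS⟩
      have hwv : G.Adj w v := (hw.mp ⟨hadj.symm, hwS⟩).1.symm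
      exact ⟨⟨hwv, lt_of_adj u v hv w hlt hwv⟩, hwS⟩
    · rintro ⟨⟨hadj, hlt⟩, hwS⟩
      have hwu : G.Adj w u := (hw.mpr ⟨hadj.symm, hwS⟩).1.symm
      exact ⟨⟨hwu, lt_of_adj v u hu w hlt hwu⟩, hwS⟩

/-- if `χ(G) ≤ 3`, then `Γ⃗_LD(G) ≥ γ_LD(G)`. -/
theorem stmt18 {V : Type*} [Fintype V] (G : SimpleGraph V)
    (hchi : G.chromaticNumber ≤ 3) :
    gammaLD G ≤ upperDirLD G := by
  have hcol : G.Colorable 3 := chromaticNumber_le_iff_colorable.mp (by exact_mod_cast hchi)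
  obtain ⟨c⟩ := hcol
  exact (gammaLD_le_gammaLDdir fun S hS => hS.isLDSet_of_colorOrientation c).trans
    (gammaLDdir_le_upperDirLD (isOrientation_colorOrientation c))
end
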